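/- Let q be a prime power, b, c ∈ F_q*, and k an integer with 1 ≤ k < q − 1; set m = gcd(k+1, q−1). Then the number of pairs (x, y) ∈ F_q* × F_q* with x ≠ y satisfying c·x^k + b/x = c·y^k + b/y is at least q − (k−1)(m−1)·√q − (4k + 1), where √q denotes the real square root of q. -/

import Mathlib

section

open Polynomial

theorem Polynomial.sum_ne_zero_of_natTrailingDegree_injOn {K ι : Type*} [Field K] (s : Finset ι)
    (T : ι → K[X]) (h : ∃ i ∈ s, T i ≠ 0)
    (hinj : ∀ i ∈ s, ∀ j ∈ s, T i ≠ 0 → T j ≠ 0 →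
      (T i).natTrailingDegree = (T j).natTrailingDegree → i = j) :
    ∑ i ∈ s, T i ≠ 0 := by
  classical
  obtain ⟨i₀, hi₀, hT⟩ := h
  obtain ⟨i, hi, hmin⟩ := (s.filter (fun i => T i ≠ 0)).exists_min_image
    (fun i => (T i).natTrailingDegree) ⟨i₀, by simp [hi₀, hT]⟩
  simp only [Finset.mem_filter] at hi hmin
  intro h0
  have hcoeff := congrArg (fun g => g.coeff (T i).natTrailingDegree) h0
  simp only [finsetSum_coeff, coeff_zero] at hcoeff
  rw [Finset.sum_eq_single i] at hcoeff
  · exact hi.2 (trailingCoeff_eq_zero.mp hcoeff)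
  · intro j hj hji
    by_cases hTj : T j = 0
    · simp [hTj]
    · apply coeff_eq_zero_of_lt_natTrailingDegree
      refine lt_of_le_of_ne (hmin j ⟨hj, hTj⟩) fun he => hji ?_
      exact (hinj i hi.1 j hj hi.2 hTj he).symm
  · exact fun h => (h hi.1).elim

theorem Polynomial.natTrailingDegree_pow_of_ne_zero {K : Type*} [Field K] {f : K[X]}
    (hf : f ≠ 0) (n : ℕ) : (f ^ n).natTrailingDegree = n * f.natTrailingDegree := by
  induction n with
  | zero => simp
  | succ n ih =>
    rw [pow_succ, natTrailingDegree_mul (pow_ne_zero n hf) hf, ih]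
    ring

theorem Nat.digits_block_unique {m w R i i' j j' o o' : ℕ} (hR : m * w + 1 = R)
    (hi : i < m) (hi' : i' < m) (ho : o < w) (ho' : o' < w)
    (h : i * w + j * R + o = i' * w + j' * R + o') : i = i' ∧ j = j' := by
  have hb : ∀ i o, i < m → o < w → i * w + o < R := fun i o hi ho => by
    have : (i + 1) * w ≤ m * w := Nat.mul_le_mul_right w hi
    nlinarith
  have h1 := hb i o hi ho
  have h2 := hb i' o' hi' ho'
  have hj : j = j' := by
    have e1 : (i * w + j * R + o) / R = j := by
      rw [show i * w + j * R + o = (i * w + o) + R * j by ring,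
        Nat.add_mul_div_left _ _ (by omega), Nat.div_eq_of_lt h1, zero_add]
    have e2 : (i' * w + j' * R + o') / R = j' := by
      rw [show i' * w + j' * R + o' = (i' * w + o') + R * j' by ring,
        Nat.add_mul_div_left _ _ (by omega), Nat.div_eq_of_lt h2, zero_add]
    rw [← e1, ← e2, h]
  subst hj
  refine ⟨?_, rfl⟩
  have e : i * w + o = i' * w + o' := by omega
  have e1 : (i * w + o) / w = i := by
    rw [add_comm, mul_comm, Nat.add_mul_div_left _ _ (by omega), Nat.div_eq_of_lt ho, zero_add]
  have e2 : (i' * w + o') / w = i' := by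
    rw [add_comm, mul_comm, Nat.add_mul_div_left _ _ (by omega), Nat.div_eq_of_lt ho', zero_add]
  rw [← e1, ← e2, e]

/-- Existence of the coefficients of the auxiliary polynomial, by pigeonhole. -/
theorem exists_stepanov_coefficients {K : Type*} [Field K] [Fintype K] {p s R m w k J : ℕ}
    [ExpChar K p] (hR : R = p ^ s) (f : K[X]) (hf : f.natDegree ≤ k) (a : K)
    (hlt : k * ((m - 1) * w) + J + (w - 1) * R < m * J * w) :
    ∃ h : Fin m × Fin J → K[X], (∃ ij, h ij ≠ 0) ∧ (∀ ij, h ij ∈ degreeLT K w) ∧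
      ∑ ij, C (a ^ (ij.1 : ℕ)) * f ^ ((m - 1 - ij.1) * w) * X ^ (ij.2 : ℕ) * h ij ^ R = 0 := by
  classical
  set D := k * ((m - 1) * w) + J + (w - 1) * R with hD
  let h : (Fin m × Fin J → Fin w → K) → Fin m × Fin J → K[X] :=
    fun c ij => ((degreeLTEquiv K w).symm (c ij) : K[X])
  let H : (Fin m × Fin J → Fin w → K) → K[X] := fun c =>
    ∑ ij, C (a ^ (ij.1 : ℕ)) * f ^ ((m - 1 - ij.1) * w) * X ^ (ij.2 : ℕ) * h c ij ^ R
  have hdeg : ∀ c ij, h c ij ∈ degreeLT K w := fun c ij => ((degreeLTEquiv K w).symm (c ij)).2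
  have hH : ∀ c, (H c).natDegree < D ∨ H c = 0 := by
    intro c
    by_cases hD0 : w = 0
    · right
      refine Finset.sum_eq_zero fun ij _ => ?_
      subst hD0
      omega
    left
    have hJ : 0 < J := by
      rcases Nat.eq_zero_or_pos J with rfl | h
      · simp at hlt
      · exact h
    refine lt_of_le_of_lt (natDegree_sum_le_of_forall_le (n := D - 1) _ _ fun ij _ => ?_)
      (by omega)
    have h1 : (h c ij).natDegree ≤ w - 1 := by
      have := mem_degreeLT.mp (hdeg c ij)
      by_cases h0 : h c ij = 0
      · simp [h0]
      · have := (natDegree_lt_iff_degree_lt h0).mpr this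
        omega
    have h2 : (f ^ ((m - 1 - ij.1) * w)).natDegree ≤ k * ((m - 1) * w) := by
      refine natDegree_pow_le.trans ?_
      rw [mul_comm]
      exact Nat.mul_le_mul hf (Nat.mul_le_mul_right _ (by omega))
    have h3 : (h c ij ^ R).natDegree ≤ (w - 1) * R := by
      refine natDegree_pow_le.trans ?_
      rw [mul_comm]
      exact Nat.mul_le_mul_right _ h1
    have h4 := natDegree_mul_le
      (p := C (a ^ (ij.1 : ℕ)) * f ^ ((m - 1 - ij.1) * w) * X ^ (ij.2 : ℕ))
      (q := h c ij ^ R)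
    have h5 := natDegree_mul_le (p := C (a ^ (ij.1 : ℕ)) * f ^ ((m - 1 - ij.1) * w))
      (q := X ^ (ij.2 : ℕ))
    have h6 := natDegree_C_mul_le (a ^ (ij.1 : ℕ)) (f ^ ((m - 1 - ij.1) * w))
    rw [natDegree_X_pow] at h5
    have := ij.2.2
    omega
  obtain ⟨c, c', hne, heq⟩ := Fintype.exists_ne_map_eq_of_card_lt
    (fun c (l : Fin D) => (H c).coeff l) (by
      simp only [Fintype.card_pi, Finset.prod_const, Finset.card_univ, Fintype.card_fin,
        Fintype.card_prod]
      rw [← pow_mul, mul_comm w]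
      exact Nat.pow_lt_pow_right Fintype.one_lt_card hlt)
  have hHeq : H c = H c' := by
    ext l
    by_cases hl : l < D
    · exact congrFun heq ⟨l, hl⟩
    · have hz : ∀ c, (H c).coeff l = 0 := fun c => by
        rcases hH c with h | h
        · exact coeff_eq_zero_of_natDegree_lt (by omega)
        · simp [h]
      rw [hz, hz]
  refine ⟨fun ij => h c ij - h c' ij, ?_, fun ij => Submodule.sub_mem _ (hdeg c ij) (hdeg c' ij),
    ?_⟩
  · by_contra! hall
    apply hne
    funext ij
    have := sub_eq_zero.mp (hall ij)
    exact (degreeLTEquiv K w).symm.injective (Subtype.ext this)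
  · rw [← sub_eq_zero.mpr hHeq, ← Finset.sum_sub_distrib]
    refine Finset.sum_congr rfl fun ij _ => ?_
    rw [hR, sub_pow_expChar_pow, ← hR]
    ring

/-- Stepanov's upper bound for the number of points at which `f ^ (w * (R + 1))` takes a given
nonzero value, over a field with `R ^ 2` elements. -/
theorem card_eval_pow_eq_le {K : Type*} [Field K] [Fintype K] {p s R m w k : ℕ}
    [ExpChar K p] (hR : R = p ^ s) (hcard : Fintype.card K = R ^ 2) (hR3 : 3 ≤ R)
    (hmw : m * w + 1 = R) (f : K[X]) (hf : f.natDegree ≤ k) (hf0 : f.coeff 0 = 0)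
    (hf1 : f.coeff 1 ≠ 0) (a : K) (ha : a ≠ 0) :
    {x : K | f.eval x ^ (w * (R + 1)) = a}.ncard ≤ w * R + (3 * k + 3) * R := by
  classical
  have hm : 0 < m := Nat.pos_of_ne_zero fun h => by subst h; omega
  have hw : 0 < w := Nat.pos_of_ne_zero fun h => by subst h; omega
  set J := w + 2 * k + 3 with hJ
  have hmw' : (m - 1) * w + w = m * w := by
    obtain ⟨m, rfl⟩ := Nat.exists_eq_add_of_lt hm
    simp; ring
  obtain ⟨h, ⟨ij₀, hne⟩, hdeg, hsum⟩ := exists_stepanov_coefficients (K := K) (m := m) (w := w)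
    (J := J) hR f hf a (by
      have hwle : w ≤ m * w := Nat.le_mul_of_pos_left w hm
      obtain ⟨w, rfl⟩ := Nat.exists_eq_add_of_lt hw
      obtain ⟨r, rfl⟩ : ∃ r, R = r + 3 := ⟨R - 3, by omega⟩
      have e : m * J * (0 + w + 1) = J * (r + 2) := by
        have : m * (0 + w + 1) = r + 2 := by omega
        rw [← this]; ring
      rw [e, hJ]
      have e2 : (m - 1) * (0 + w + 1) ≤ r + 2 := by omega
      have e3 := Nat.mul_le_mul_left k e2
      simp only [Nat.add_sub_cancel]
      nlinarith [Nat.zero_le (k * r)])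
  set G : K[X] := ∑ ij : Fin m × Fin J, f ^ ((ij.1 : ℕ) * w) * X ^ ((ij.2 : ℕ) * R) * h ij with hG
  have hf0' : f ≠ 0 := fun h => hf1 (by simp [h])
  have htr : f.natTrailingDegree = 1 := by
    apply le_antisymm (natTrailingDegree_le_of_ne_zero hf1)
    rw [Nat.one_le_iff_ne_zero]
    intro h0
    rw [natTrailingDegree_eq_zero] at h0
    exact h0.elim hf0' (fun h => h hf0)
  have hlt : ∀ ij, h ij ≠ 0 → (h ij).natDegree < w := fun ij h0 =>
    (natDegree_lt_iff_degree_lt h0).mpr (mem_degreeLT.mp (hdeg ij))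
  have hord : ∀ ij, h ij ≠ 0 →
      (f ^ ((ij.1 : ℕ) * w) * X ^ ((ij.2 : ℕ) * R) * h ij).natTrailingDegree
      = ij.1 * w + ij.2 * R + (h ij).natTrailingDegree := by
    intro ij h0
    rw [natTrailingDegree_mul (by simp [hf0']) h0,
      natTrailingDegree_mul (pow_ne_zero _ hf0') (by simp),
      natTrailingDegree_pow_of_ne_zero hf0', htr]
    simp
  have hG0 : G ≠ 0 := by
    apply sum_ne_zero_of_natTrailingDegree_injOn
    · exact ⟨ij₀, Finset.mem_univ _, by simp [hf0', hne]⟩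
    · intro ij _ ij' _ h0 h0' heq
      have h0 := right_ne_zero_of_mul h0
      have h0' := right_ne_zero_of_mul h0'
      rw [hord _ h0, hord _ h0'] at heq
      have := Nat.digits_block_unique hmw ij.1.2 ij'.1.2
        ((natTrailingDegree_le_natDegree _).trans_lt (hlt _ h0))
        ((natTrailingDegree_le_natDegree _).trans_lt (hlt _ h0')) heq
      exact Prod.ext (Fin.ext this.1) (Fin.ext this.2)
  have hGdeg : G.natDegree ≤ w * R + (3 * k + 3) * R := by
    refine natDegree_sum_le_of_forall_le _ _ fun ij _ => ?_
    by_cases h0 : h ij = 0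
    · simp [h0]
    have h1 := hlt ij h0
    have h2 : (f ^ ((ij.1 : ℕ) * w)).natDegree ≤ k * R := by
      refine natDegree_pow_le.trans ?_
      rw [mul_comm]
      refine Nat.mul_le_mul hf ?_
      have := Nat.mul_le_mul_right w (Nat.le_of_lt ij.1.2)
      omega
    have h3 : (X ^ ((ij.2 : ℕ) * R) : K[X]).natDegree + R ≤ J * R := by
      rw [natDegree_X_pow]
      have := Nat.mul_le_mul_right R ij.2.2
      linarith
    have h4 := natDegree_mul_le (p := f ^ ((ij.1 : ℕ) * w) * X ^ ((ij.2 : ℕ) * R)) (q := h ij)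
    have h5 := natDegree_mul_le (p := f ^ ((ij.1 : ℕ) * w)) (q := X ^ ((ij.2 : ℕ) * R))
    have h6 : w ≤ m * w := Nat.le_mul_of_pos_left w hm
    have h7 : J * R = w * R + (2 * k + 3) * R := by rw [hJ]; ring
    have h8 : (3 * k + 3) * R = k * R + (2 * k + 3) * R := by ring
    omega
  have hroot : {x : K | f.eval x ^ (w * (R + 1)) = a} ⊆ (G.roots.toFinset : Set K) := by
    intro x hx
    simp only [Set.mem_ofPred_eq] at hx
    have hfx : f.eval x ≠ 0 := by
      intro h0
      rw [h0, zero_pow (by positivity)] at hx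
      exact ha hx.symm
    simp only [Finset.mem_coe, Multiset.mem_toFinset, mem_roots hG0, IsRoot]
    have key : (G.eval x) ^ R * f.eval x ^ ((m - 1) * w) = 0 := by
      have h1 := congrArg (eval x) hsum
      rw [eval_zero, eval_finsetSum] at h1
      rw [← h1, hG, eval_finsetSum, hR, sum_pow_char_pow, ← hR, Finset.sum_mul]
      refine Finset.sum_congr rfl fun ij _ => ?_
      simp only [eval_mul, eval_pow, eval_X, eval_C]
      have hxq : x ^ (R * R) = x := by
        rw [← sq, ← hcard]; exact FiniteField.pow_card x
      have hsplit : (m - 1) * w = ij.1 * w + (m - 1 - ij.1) * w := by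
        rw [← add_mul]; congr 1; omega
      rw [hsplit, ← hx, mul_pow, mul_pow, ← pow_mul x, mul_assoc (ij.2 : ℕ), mul_comm (ij.2 : ℕ),
        pow_mul x, hxq]
      ring
    have := (mul_eq_zero.mp key).resolve_right (pow_ne_zero _ hfx)
    exact pow_eq_zero_iff (by omega) |>.mp this
  calc _ ≤ (G.roots.toFinset : Set K).ncard := Set.ncard_le_ncard hroot (Finset.finite_toSet _)
    _ = G.roots.toFinset.card := Set.ncard_coe_finset _
    _ ≤ Multiset.card G.roots := Multiset.toFinset_card_le _
    _ ≤ _ := (card_roots' G).trans hGdeg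

theorem MulChar.norm_apply_le_one {F : Type*} [Field F] [Fintype F] (χ : MulChar F ℂ) (a : F) :
    ‖χ a‖ ≤ 1 := by
  by_cases ha : a = 0
  · simp [ha]
  · refine (Complex.norm_eq_one_of_pow_eq_one (n := Fintype.card F - 1) ?_ ?_).le
    · rw [← map_pow, FiniteField.pow_card_sub_one_eq_one a ha, map_one]
    · have := Fintype.one_lt_card (α := F)
      omega

/-- Over extensions of even degree, character sums of norms are of the order of the square root
of the number of elements. -/
theorem norm_sum_mulChar_norm_aeval_le {F K : Type*} [Field F] [Fintype F] [Field K] [Fintype K]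
    [Algebra F K] {k r : ℕ} (hr : r ≠ 0) (hK : Module.finrank F K = 2 * r)
    (hq : 3 ≤ Fintype.card F) {χ : MulChar F ℂ} (hχ : χ ≠ 1) (f : F[X]) (hf : f.natDegree ≤ k)
    (hf0 : f.coeff 0 = 0) (hf1 : f.coeff 1 ≠ 0) :
    ‖∑ x : K, χ (Algebra.norm F (aeval x f))‖ ≤
      ((Fintype.card F * (3 * k + 3) + k : ℕ) : ℝ) * (Fintype.card F : ℝ) ^ r := by
  classical
  set q := Fintype.card F with hqdef
  obtain ⟨p, hp⟩ := CharP.exists F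
  obtain ⟨s, hpp, hcardF⟩ := FiniteField.card F p
  have : Fact p.Prime := ⟨hpp⟩
  have : CharP K p := charP_of_injective_algebraMap (algebraMap F K).injective p
  set R := q ^ r with hR
  have hRp : R = p ^ (s * r) := by rw [hR, hqdef, hcardF, pow_mul]
  have hqR : q ≤ R := Nat.le_self_pow hr q
  have hcard : Fintype.card K = R ^ 2 := by
    rw [Module.card_eq_pow_finrank (K := F), hK, hR, ← pow_mul, mul_comm]
  obtain ⟨w, hw⟩ : q - 1 ∣ R - 1 := by
    simpa using Nat.sub_dvd_pow_sub_pow q 1 r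
  have hmw : (q - 1) * w + 1 = R := by omega
  have hexp : (Nat.card K - 1) / (Nat.card F - 1) = w * (R + 1) := by
    rw [Nat.card_eq_fintype_card, Nat.card_eq_fintype_card, hcard, ← hqdef]
    refine Nat.div_eq_of_eq_mul_right (by omega) ?_
    have : R ^ 2 - 1 = (R - 1) * (R + 1) := by
      obtain ⟨t, ht⟩ : ∃ t, R = t + 1 := ⟨R - 1, by omega⟩
      rw [ht]
      simp only [Nat.add_sub_cancel]
      rw [show (t + 1) ^ 2 = t * (t + 1 + 1) + 1 by ring]
      simp
    rw [this, hw, mul_assoc]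
  set U : ℕ := w * R + (3 * k + 3) * R with hU
  have hbound : ∀ a : F, a ≠ 0 →
      (Finset.univ.filter fun x : K => Algebra.norm F (aeval x f) = a).card ≤ U := by
    intro a ha
    have h1 := card_eval_pow_eq_le (K := K) (m := q - 1) (w := w) (k := k) (p := p) hRp hcard
      (by omega) hmw (f.map (algebraMap F K)) (by simpa using hf) (by simp [hf0])
      (by simpa using hf1) (algebraMap F K a) (by simpa using ha)
    rw [← Set.ncard_coe_finset]
    convert h1 using 2
    ext x
    simp only [Finset.coe_filter, Finset.mem_univ, true_and, Set.mem_ofPred_eq]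
    rw [← (algebraMap F K).injective.eq_iff, FiniteField.algebraMap_norm_eq_pow, hexp,
      eval_map_algebraMap]
  set c : F → ℕ := fun a => (Finset.univ.filter fun x : K => Algebra.norm F (aeval x f) = a).card
    with hc
  have hf0' : f ≠ 0 := fun h => hf1 (by simp [h])
  have hzero : c 0 ≤ k := by
    have hsub : (Finset.univ.filter fun x : K => Algebra.norm F (aeval x f) = 0) ⊆
        (f.map (algebraMap F K)).roots.toFinset := by
      intro x hx
      simp only [Finset.mem_filter, Finset.mem_univ, true_and, Algebra.norm_eq_zero_iff] at hx
      rw [Multiset.mem_toFinset, mem_roots (by simpa using hf0'), IsRoot, eval_map_algebraMap, hx]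
    refine (Finset.card_le_card hsub).trans ((Multiset.toFinset_card_le _).trans ?_)
    refine (card_roots' _).trans ?_
    simpa using hf
  have hsum : ∑ a, c a = R ^ 2 := by
    rw [← hcard, ← Finset.card_univ,
      Finset.card_eq_sum_card_fiberwise (f := fun x : K => Algebra.norm F (aeval x f))
      (t := Finset.univ) (by simp)]
  have hS : ∑ x : K, χ (Algebra.norm F (aeval x f)) = ∑ a, (c a : ℂ) * χ a := by
    rw [← Finset.sum_fiberwise_of_maps_to (s := Finset.univ) (t := Finset.univ)
      (g := fun x : K => Algebra.norm F (aeval x f)) (by simp)]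
    refine Finset.sum_congr rfl fun a _ => ?_
    rw [Finset.sum_congr rfl (g := fun _ => χ a) (by
      intro x hx
      rw [(Finset.mem_filter.mp hx).2])]
    simp [hc]
  have hS' : ∑ a, (c a : ℂ) * χ a = - ∑ a ∈ Finset.univ.erase 0, ((U : ℂ) - c a) * χ a := by
    have h0 : ∑ a, (U : ℂ) * χ a = 0 := by
      rw [← Finset.mul_sum, MulChar.sum_eq_zero_of_ne_one hχ, mul_zero]
    have h1 : ∑ a ∈ Finset.univ.erase 0, ((U : ℂ) - c a) * χ a = ∑ a, ((U : ℂ) - c a) * χ a := by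
      refine Finset.sum_erase _ ?_
      simp [MulChar.map_zero]
    rw [h1]
    simp only [sub_mul, Finset.sum_sub_distrib, h0]
    ring
  rw [hS, hS', norm_neg]
  have hle : ‖∑ a ∈ Finset.univ.erase 0, ((U : ℂ) - c a) * χ a‖ ≤
      ∑ a ∈ Finset.univ.erase (0 : F), ((U : ℝ) - c a) := by
    refine (norm_sum_le _ _).trans (Finset.sum_le_sum fun a ha => ?_)
    have hca : (c a : ℝ) ≤ U := by exact_mod_cast hbound a (Finset.ne_of_mem_erase ha)
    rw [norm_mul]
    have h1 : ‖(U : ℂ) - c a‖ = (U : ℝ) - c a := by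
      rw [show (U : ℂ) - c a = (((U : ℝ) - c a : ℝ) : ℂ) by push_cast; rfl, Complex.norm_real,
        Real.norm_of_nonneg (by linarith)]
    rw [h1]
    exact mul_le_of_le_one_right (by linarith) (χ.norm_apply_le_one a)
  refine hle.trans ?_
  have htot : ∑ a ∈ Finset.univ.erase (0 : F), (c a : ℝ) = (R : ℝ) ^ 2 - c 0 := by
    rw [Finset.sum_erase_eq_sub (Finset.mem_univ _)]
    congr 1
    exact_mod_cast hsum
  rw [Finset.sum_sub_distrib, htot]
  simp only [Finset.sum_const, Finset.card_erase_of_mem (Finset.mem_univ _), Finset.card_univ,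
    ← hqdef, nsmul_eq_mul]
  have hq1 : ((q - 1 : ℕ) : ℝ) = (q : ℝ) - 1 := by
    rw [Nat.cast_sub (by omega)]; simp
  have hmwR : ((q : ℝ) - 1) * w + 1 = R := by
    rw [← hq1]; exact_mod_cast hmw
  have hR1 : (1 : ℝ) ≤ R := by exact_mod_cast (by omega : 1 ≤ R)
  have hz : (c 0 : ℝ) ≤ k := by exact_mod_cast hzero
  rw [hq1, hU]
  have hRR : (q : ℝ) ^ r = R := by rw [hR]; push_cast; rfl
  rw [hRR]
  push_cast
  have e : ((q : ℝ) - 1) * (w * R + (3 * k + 3) * R) = (R - 1) * R + (q - 1) * (3 * k + 3) * R := by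
    rw [← hmwR]; ring
  rw [e]
  have hk0 : (0 : ℝ) ≤ k := Nat.cast_nonneg k
  nlinarith [mul_nonneg hk0 (sub_nonneg.mpr hR1)]

theorem Polynomial.finite_setOf_monic_natDegree_eq (F : Type*) [Field F] [Finite F] (n : ℕ) :
    {g : F[X] | g.Monic ∧ g.natDegree = n}.Finite := by
  have : Finite (degreeLT F (n + 1)) := .of_equiv _ (degreeLTEquiv F (n + 1)).symm.toEquiv
  refine Set.Finite.subset (Set.toFinite (degreeLT F (n + 1) : Set F[X])) fun g hg => ?_
  rw [SetLike.mem_coe, mem_degreeLT, degree_eq_natDegree hg.1.ne_zero, hg.2]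
  exact_mod_cast Nat.lt_succ_self n

/-- The monic polynomials of degree `n` over a finite field. -/
noncomputable def monicOfDegree (F : Type*) [Field F] [Finite F] (n : ℕ) : Finset F[X] :=
  (finite_setOf_monic_natDegree_eq F n).toFinset

open Classical in
/-- The monic irreducible polynomials of degree `n` over a finite field. -/
noncomputable def monicIrreducibleOfDegree (F : Type*) [Field F] [Finite F] (n : ℕ) :
    Finset F[X] :=
  (monicOfDegree F n).filter Irreducible

theorem mem_monicOfDegree {F : Type*} [Field F] [Finite F] {n : ℕ} {g : F[X]} :
    g ∈ monicOfDegree F n ↔ g.Monic ∧ g.natDegree = n := by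
  simp [monicOfDegree]

theorem mem_monicIrreducibleOfDegree {F : Type*} [Field F] [Finite F] {n : ℕ} {g : F[X]} :
    g ∈ monicIrreducibleOfDegree F n ↔ g.Monic ∧ g.natDegree = n ∧ Irreducible g := by
  simp [monicIrreducibleOfDegree, mem_monicOfDegree, and_assoc]

/-- A weight on monic polynomials that is completely multiplicative. -/
structure IsMonicMultiplicative {F : Type*} [Field F] (lam : F[X] → ℂ) : Prop where
  map_one : lam 1 = 1
  map_mul : ∀ g h : F[X], g.Monic → h.Monic → lam (g * h) = lam g * lam h

theorem IsMonicMultiplicative.map_pow {F : Type*} [Field F] {lam : F[X] → ℂ}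
    (hlam : IsMonicMultiplicative lam) {g : F[X]} (hg : g.Monic) (i : ℕ) :
    lam (g ^ i) = lam g ^ i := by
  induction i with
  | zero => simp [hlam.map_one]
  | succ i ih => rw [pow_succ, pow_succ, hlam.map_mul _ _ (hg.pow i) hg, ih]

/-- The sum of a weight over the monic polynomials of degree `n`: the `n`-th coefficient of
the associated `L`-function. -/
noncomputable def lCoeff {F : Type*} [Field F] [Finite F] (lam : F[X] → ℂ) (n : ℕ) : ℂ :=
  ∑ g ∈ monicOfDegree F n, lam g

/-- The weighted sum over powers of monic irreducible polynomials of total degree `j`. -/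
noncomputable def primePowerSum {F : Type*} [Field F] [Finite F] (lam : F[X] → ℂ) (j : ℕ) : ℂ :=
  ∑ x ∈ j.divisorsAntidiagonal, ∑ P ∈ monicIrreducibleOfDegree F x.1, (x.1 : ℂ) * lam P ^ x.2

theorem lCoeff_zero {F : Type*} [Field F] [Finite F] {lam : F[X] → ℂ}
    (hlam : IsMonicMultiplicative lam) : lCoeff lam 0 = 1 := by
  have : monicOfDegree F 0 = {1} := by
    ext g
    rw [mem_monicOfDegree, Finset.mem_singleton]
    constructor
    · rintro ⟨h1, h2⟩
      exact h1.natDegree_eq_zero.mp h2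
    · rintro rfl
      simp
  rw [lCoeff, this, Finset.sum_singleton, hlam.map_one]

open Classical in
theorem Polynomial.Monic.natDegree_eq_sum_prime_powers {F : Type*} [Field F] [Finite F] {n : ℕ}
    {g : F[X]} (hg : g ∈ monicOfDegree F n) :
    n = ∑ d ∈ Finset.Icc 1 n, ∑ P ∈ monicIrreducibleOfDegree F d, ∑ i ∈ Finset.Icc 1 n,
      if P ^ i ∣ g then d else 0 := by
  obtain ⟨hmon, hdeg⟩ := mem_monicOfDegree.mp hg
  have hg0 := hmon.ne_zero
  set s := UniqueFactorizationMonoid.normalizedFactors g with hs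
  have hprod : s.prod = g := by
    rw [hs, UniqueFactorizationMonoid.prod_normalizedFactors_eq hg0, hmon.normalize_eq_self]
  have hmem : ∀ P ∈ s, P.Monic ∧ Irreducible P := fun P hP => by
    have hirr := UniqueFactorizationMonoid.irreducible_of_normalized_factor P hP
    refine ⟨?_, hirr⟩
    rw [← UniqueFactorizationMonoid.normalize_normalized_factor P hP]
    exact monic_normalize hirr.ne_zero
  have hdegs : n = ∑ P ∈ s.toFinset, s.count P * P.natDegree := by
    rw [← hdeg, ← hprod, natDegree_multiset_prod_of_monic _ (fun P hP => (hmem P hP).1),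
      Finset.sum_multiset_map_count]
    simp [hs]
  have hcount : ∀ P : F[X], P.Monic → Irreducible P →
      ∑ i ∈ Finset.Icc 1 n, (if P ^ i ∣ g then P.natDegree else 0) =
      s.count P * P.natDegree := by
    intro P hP hirr
    have hdvd : ∀ i, P ^ i ∣ g ↔ i ≤ s.count P := by
      intro i
      rw [pow_dvd_iff_le_emultiplicity,
        UniqueFactorizationMonoid.emultiplicity_eq_count_normalizedFactors hirr hg0,
        hP.normalize_eq_self]
      simp [hs]
    have hle : s.count P ≤ n := by
      have h1 := natDegree_le_of_dvd ((hdvd _).mpr le_rfl) hg0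
      rw [hP.natDegree_pow, hdeg] at h1
      exact le_trans (Nat.le_mul_of_pos_right _ hirr.natDegree_pos) h1
    rw [← Finset.sum_filter, Finset.sum_const, smul_eq_mul]
    congr 1
    have : (Finset.Icc 1 n).filter (fun i => P ^ i ∣ g) = Finset.Icc 1 (s.count P) := by
      ext i
      simp only [Finset.mem_filter, Finset.mem_Icc, hdvd]
      omega
    rw [this]
    simp
  have hstep : ∀ d ∈ Finset.Icc 1 n, ∑ P ∈ monicIrreducibleOfDegree F d,
      ∑ i ∈ Finset.Icc 1 n, (if P ^ i ∣ g then d else 0) =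
      ∑ P ∈ s.toFinset with P.natDegree = d, s.count P * P.natDegree := by
    intro d _
    symm
    refine Finset.sum_subset_zero_on_sdiff ?_ ?_ ?_
    · intro P hP
      rw [Finset.mem_filter, Multiset.mem_toFinset] at hP
      exact mem_monicIrreducibleOfDegree.mpr ⟨(hmem P hP.1).1, hP.2, (hmem P hP.1).2⟩
    · intro P hP
      rw [Finset.mem_sdiff, mem_monicIrreducibleOfDegree, Finset.mem_filter] at hP
      have hc := hcount P hP.1.1 hP.1.2.2
      rw [hP.1.2.1] at hc
      rw [hc, Multiset.count_eq_zero.mpr, zero_mul]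
      intro h
      exact hP.2 ⟨Multiset.mem_toFinset.mpr h, hP.1.2.1⟩
    · intro P hP
      rw [Finset.mem_filter, Multiset.mem_toFinset] at hP
      rw [← hcount P (hmem P hP.1).1 (hmem P hP.1).2, hP.2]
  rw [Finset.sum_congr rfl hstep, Finset.sum_fiberwise_of_maps_to, ← hdegs]
  intro P hP
  rw [Multiset.mem_toFinset] at hP
  rw [Finset.mem_Icc]
  refine ⟨(hmem P hP).2.natDegree_pos, ?_⟩
  rw [← hdeg]
  exact natDegree_le_of_dvd (UniqueFactorizationMonoid.dvd_of_mem_normalizedFactors hP) hg0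

open Classical in
theorem IsMonicMultiplicative.sum_filter_dvd {F : Type*} [Field F] [Finite F] {lam : F[X] → ℂ}
    (hlam : IsMonicMultiplicative lam) {Q : F[X]} (hQ : Q.Monic) (n : ℕ) :
    ∑ g ∈ monicOfDegree F n with Q ∣ g, lam g =
      if Q.natDegree ≤ n then lam Q * lCoeff lam (n - Q.natDegree) else 0 := by
  split_ifs with h
  · rw [lCoeff, Finset.mul_sum]
    symm
    refine Finset.sum_bij (fun h _ => Q * h) ?_ ?_ ?_ ?_
    · intro g hg
      rw [mem_monicOfDegree] at hg
      rw [Finset.mem_filter, mem_monicOfDegree]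
      refine ⟨⟨hQ.mul hg.1, ?_⟩, dvd_mul_right _ _⟩
      rw [hQ.natDegree_mul hg.1]
      omega
    · intro g _ g' _ he
      exact mul_left_cancel₀ hQ.ne_zero he
    · intro g hg
      rw [Finset.mem_filter, mem_monicOfDegree] at hg
      obtain ⟨⟨hm, hd⟩, c, rfl⟩ := hg
      have hc := hQ.of_mul_monic_left hm
      rw [hQ.natDegree_mul hc] at hd
      exact ⟨c, mem_monicOfDegree.mpr ⟨hc, by omega⟩, rfl⟩
    · intro g hg
      exact (hlam.map_mul _ _ hQ (mem_monicOfDegree.mp hg).1).symm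
  · refine Finset.sum_eq_zero fun g hg => ?_
    rw [Finset.mem_filter, mem_monicOfDegree] at hg
    exact absurd (hg.1.2 ▸ natDegree_le_of_dvd hg.2 hg.1.1.ne_zero) h

theorem sum_Icc_divisorsAntidiagonal (n : ℕ) (G : ℕ → ℕ → ℕ → ℂ) :
    ∑ j ∈ Finset.Icc 1 n, ∑ x ∈ j.divisorsAntidiagonal, G x.1 x.2 j =
      ∑ d ∈ Finset.Icc 1 n, ∑ i ∈ Finset.Icc 1 n, if d * i ≤ n then G d i (d * i) else 0 := by
  rw [← Finset.sum_product', Finset.sum_sigma', ← Finset.sum_filter]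
  refine Finset.sum_bij' (fun x _ => x.2) (fun y _ => ⟨y.1 * y.2, y⟩) ?_ ?_ ?_ ?_ ?_
  · rintro ⟨j, d, i⟩ h
    simp only [Finset.mem_sigma, Finset.mem_Icc, Nat.mem_divisorsAntidiagonal] at h
    simp only [Finset.mem_filter, Finset.mem_product, Finset.mem_Icc]
    obtain ⟨⟨h1, h2⟩, h3, h4⟩ := h
    have hd : d ≠ 0 := by rintro rfl; simp at h3; omega
    have hi : i ≠ 0 := by rintro rfl; simp at h3; omega
    have := Nat.le_mul_of_pos_right d (Nat.pos_of_ne_zero hi)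
    have := Nat.le_mul_of_pos_left i (Nat.pos_of_ne_zero hd)
    omega
  · rintro ⟨d, i⟩ h
    simp only [Finset.mem_filter, Finset.mem_product, Finset.mem_Icc] at h
    simp only [Finset.mem_sigma, Finset.mem_Icc, Nat.mem_divisorsAntidiagonal]
    have : 0 < d * i := Nat.mul_pos (by omega) (by omega)
    exact ⟨⟨this, h.2⟩, trivial, this.ne'⟩
  · rintro ⟨j, d, i⟩ h
    simp only [Finset.mem_sigma, Nat.mem_divisorsAntidiagonal] at h
    obtain ⟨_, rfl, _⟩ := h
    rfl
  · rintro ⟨d, i⟩ _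
    rfl
  · rintro ⟨j, d, i⟩ h
    simp only [Finset.mem_sigma, Nat.mem_divisorsAntidiagonal] at h
    obtain ⟨_, rfl, _⟩ := h
    rfl

/-- The recursion between coefficients and prime power sums, i.e. the logarithmic derivative of
the Euler product. -/
theorem IsMonicMultiplicative.natCast_mul_lCoeff {F : Type*} [Field F] [Finite F]
    {lam : F[X] → ℂ} (hlam : IsMonicMultiplicative lam) (n : ℕ) :
    (n : ℂ) * lCoeff lam n =
      ∑ j ∈ Finset.Icc 1 n, primePowerSum lam j * lCoeff lam (n - j) := by
  classical
  have h1 : (n : ℂ) * lCoeff lam n = ∑ g ∈ monicOfDegree F n, ∑ d ∈ Finset.Icc 1 n,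
      ∑ P ∈ monicIrreducibleOfDegree F d, ∑ i ∈ Finset.Icc 1 n,
      if P ^ i ∣ g then (d : ℂ) * lam g else 0 := by
    rw [lCoeff, Finset.mul_sum]
    refine Finset.sum_congr rfl fun g hg => ?_
    have h := congrArg (Nat.cast (R := ℂ)) (Monic.natDegree_eq_sum_prime_powers hg)
    conv_lhs => rw [h]
    push_cast
    simp only [Finset.sum_mul, ite_mul, zero_mul]
  have h2 : ∑ j ∈ Finset.Icc 1 n, primePowerSum lam j * lCoeff lam (n - j) =
      ∑ j ∈ Finset.Icc 1 n, ∑ x ∈ j.divisorsAntidiagonal,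
      ∑ P ∈ monicIrreducibleOfDegree F x.1, (x.1 : ℂ) * lam P ^ x.2 * lCoeff lam (n - j) := by
    refine Finset.sum_congr rfl fun j _ => ?_
    rw [primePowerSum, Finset.sum_mul]
    refine Finset.sum_congr rfl fun x _ => ?_
    rw [Finset.sum_mul]
  rw [h1, h2, sum_Icc_divisorsAntidiagonal n (fun d i j =>
    ∑ P ∈ monicIrreducibleOfDegree F d, (d : ℂ) * lam P ^ i * lCoeff lam (n - j)), Finset.sum_comm]
  refine Finset.sum_congr rfl fun d _ => ?_
  rw [Finset.sum_comm]
  simp_rw [Finset.sum_comm (s := monicOfDegree F n)]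
  rw [Finset.sum_comm]
  refine Finset.sum_congr rfl fun i _ => ?_
  have h3 : ∀ P ∈ monicIrreducibleOfDegree F d,
      ∑ g ∈ monicOfDegree F n, (if P ^ i ∣ g then (d : ℂ) * lam g else 0) =
      if d * i ≤ n then (d : ℂ) * lam P ^ i * lCoeff lam (n - d * i) else 0 := by
    intro P hP
    obtain ⟨hm, hd, _⟩ := mem_monicIrreducibleOfDegree.mp hP
    rw [← Finset.sum_filter, ← Finset.mul_sum, hlam.sum_filter_dvd (hm.pow i), natDegree_pow, hd,
      hlam.map_pow hm, mul_comm i d]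
    split_ifs <;> ring
  rw [Finset.sum_congr rfl h3]
  split_ifs <;> simp

/-- The multiplicative weight `g ↦ χ (Res(g, f))` attached to a polynomial and a character. -/
noncomputable def resultantWeight {F : Type*} [Field F] (χ : MulChar F ℂ) (f g : F[X]) : ℂ :=
  χ (resultant g f)

theorem isMonicMultiplicative_resultantWeight {F : Type*} [Field F] (χ : MulChar F ℂ)
    (f : F[X]) : IsMonicMultiplicative (resultantWeight χ f) where
  map_one := by
    rw [resultantWeight, resultant_one_left]
    simp
  map_mul g h hg hh := by
    rw [resultantWeight, hg.natDegree_mul hh, resultant_mul_left _ _ _ _ le_rfl, _root_.map_mul]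
    rfl

theorem algebraMap_resultant_of_monic {F E : Type*} [Field F] [Field E] [IsAlgClosed E]
    [Algebra F E] {f : F[X]} (hf : f.Monic) (g : F[X]) :
    algebraMap F E (resultant f g) = ((f.aroots E).map fun β => aeval β g).prod := by
  have hdeg : (f.map (algebraMap F E)).natDegree = f.natDegree := natDegree_map _
  rw [← resultant_map_map]
  conv_lhs => rw [← hdeg]
  rw [resultant_eq_prod_eval _ _ _ natDegree_map_le (IsAlgClosed.splits _),
    (hf.map _).leadingCoeff, one_pow, one_mul]
  simp [aroots, eval_map_algebraMap]

theorem resultantWeight_eq_mul {F : Type*} [Field F] (χ : MulChar F ℂ) {f g g' u : F[X]} {v : F}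
    (hf : f.Monic) (hdeg : g'.natDegree = g.natDegree)
    (hroots : ∀ β ∈ f.aroots (AlgebraicClosure F), aeval β g' = aeval β u * aeval β g)
    (hu : ((f.aroots (AlgebraicClosure F)).map fun β => aeval β u).prod =
      algebraMap F (AlgebraicClosure F) v) :
    resultantWeight χ f g' = χ v * resultantWeight χ f g := by
  have hv : resultant f g' = v * resultant f g := by
    apply (algebraMap F (AlgebraicClosure F)).injective
    rw [_root_.map_mul, algebraMap_resultant_of_monic hf, algebraMap_resultant_of_monic hf,
      Multiset.map_congr rfl hroots, Multiset.prod_map_mul, hu]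
  rw [resultantWeight, resultantWeight, resultant_comm, resultant_comm g, hv, hdeg,
    ← _root_.map_mul]
  congr 1
  ring

theorem lCoeff_resultantWeight_eq_zero {F : Type*} [Field F] [Fintype F] {χ : MulChar F ℂ}
    (hχ : χ ≠ 1) {f : F[X]} (hf : f.Monic) (hf0 : f.coeff 0 = 0) (hf1 : f.coeff 1 ≠ 0) {n : ℕ}
    (hn : f.natDegree ≤ n) : lCoeff (resultantWeight χ f) n = 0 := by
  classical
  obtain ⟨v, hv⟩ := MulChar.ne_one_iff.mp hχ
  obtain ⟨h, rfl⟩ := X_dvd_iff.mpr hf0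
  have hh0 : h.coeff 0 ≠ 0 := by simpa using hf1
  have hh : h ≠ 0 := fun h' => hh0 (by simp [h'])
  set u : F[X] := 1 + C (((v : F) - 1) * (h.coeff 0)⁻¹) * h with hu
  have hu0 : u.coeff 0 = v := by
    simp [hu, hh0]
  have hcop : IsCoprime (X * h) u := by
    apply IsCoprime.mul_left
    · refine (irreducible_X.coprime_iff_not_dvd).mpr fun hd => ?_
      rw [X_dvd_iff, hu0] at hd
      exact v.ne_zero hd
    · exact ⟨-C (((v : F) - 1) * (h.coeff 0)⁻¹), 1, by rw [hu]; ring⟩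
  set Φ : F[X] → F[X] := fun g => g + ((u - 1) * g) %ₘ (X * h) with hΦ
  have hdvd : ∀ g, X * h ∣ Φ g - u * g := fun g => by
    have := dvd_modByMonic_sub ((u - 1) * g) (X * h)
    rw [hΦ]
    convert this using 1
    ring
  have hdlt : ∀ g, (((u - 1) * g) %ₘ (X * h)).degree < (X * h).degree := fun g =>
    degree_modByMonic_lt _ hf
  have hmaps : ∀ g ∈ monicOfDegree F n, Φ g ∈ monicOfDegree F n := by
    intro g hg
    rw [mem_monicOfDegree] at hg ⊢
    have hlt : (((u - 1) * g) %ₘ (X * h)).degree < g.degree := by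
      refine (hdlt g).trans_le ?_
      rw [degree_eq_natDegree hf.ne_zero, degree_eq_natDegree hg.1.ne_zero, hg.2]
      exact_mod_cast hn
    exact ⟨hg.1.add_of_left hlt, by rw [natDegree_add_eq_left_of_degree_lt hlt, hg.2]⟩
  have hinj : Set.InjOn Φ (monicOfDegree F n) := by
    intro g _ g' _ he
    have h1 : X * h ∣ u * (g - g') := by
      have := dvd_sub (hdvd g') (hdvd g)
      rw [he] at this
      convert this using 1
      ring
    have h2 := hcop.dvd_of_dvd_mul_left h1
    have h3 : (g - g').degree < (X * h).degree := by
      have : g - g' = ((u - 1) * g') %ₘ (X * h) - ((u - 1) * g) %ₘ (X * h) := by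
        simp only [hΦ] at he
        linear_combination he
      rw [this]
      exact (degree_sub_le _ _).trans_lt (max_lt (hdlt g') (hdlt g))
    exact sub_eq_zero.mp (eq_zero_of_dvd_of_degree_lt h2 h3)
  have himage : (monicOfDegree F n).image Φ = monicOfDegree F n :=
    Finset.eq_of_subset_of_card_le (Finset.image_subset_iff.mpr hmaps)
      (Finset.card_image_of_injOn hinj).ge
  have haroots : (X * h).aroots (AlgebraicClosure F) =
      0 ::ₘ h.aroots (AlgebraicClosure F) := by
    rw [aroots_mul (mul_ne_zero X_ne_zero hh), aroots_X, Multiset.singleton_add]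
  have hlam : ∀ g ∈ monicOfDegree F n, resultantWeight χ (X * h) (Φ g) =
      χ v * resultantWeight χ (X * h) g := by
    intro g hg
    refine resultantWeight_eq_mul χ (u := u) hf ?_ ?_ ?_
    · rw [(mem_monicOfDegree.mp (hmaps g hg)).2, (mem_monicOfDegree.mp hg).2]
    · intro β hβ
      have hβ' := (mem_aroots.mp hβ).2
      obtain ⟨d, hd⟩ := hdvd g
      have := congrArg (aeval β) hd
      rw [_root_.map_mul, hβ', zero_mul, map_sub, _root_.map_mul] at this
      exact sub_eq_zero.mp this
    · rw [haroots, Multiset.map_cons, Multiset.prod_cons, Multiset.prod_eq_one, mul_one,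
        aeval_def, eval₂_at_zero, hu0]
      intro z hz
      obtain ⟨β, hβ, rfl⟩ := Multiset.mem_map.mp hz
      simp [hu, (mem_aroots.mp hβ).2]
  have hsum : lCoeff (resultantWeight χ (X * h)) n =
      χ v * lCoeff (resultantWeight χ (X * h)) n := by
    conv_lhs => rw [lCoeff, ← himage, Finset.sum_image hinj]
    rw [lCoeff, Finset.mul_sum]
    exact Finset.sum_congr rfl hlam
  have : (1 - χ v) * lCoeff (resultantWeight χ (X * h)) n = 0 := by
    linear_combination hsum
  exact (mul_eq_zero.mp this).resolve_left (sub_ne_zero.mpr (Ne.symm hv))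

theorem norm_aeval_eq_resultant_minpoly_pow {F K : Type*} [Field F] [Finite F] [Field K]
    [Finite K] [Algebra F K] (f : F[X]) (x : K) :
    Algebra.norm F (aeval x f) =
      resultant (minpoly F x) f ^ (Module.finrank F K / (minpoly F x).natDegree) := by
  classical
  have : FiniteDimensional F K := Module.Finite.of_finite
  have hx : IsIntegral F x := Algebra.IsIntegral.isIntegral x
  set L := IntermediateField.adjoin F {x} with hL
  set y : L := IntermediateField.AdjoinSimple.gen F x with hy
  have hxy : aeval x f = algebraMap L K (aeval y f) := by
    rw [← aeval_algebraMap_apply]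
    rfl
  have hfin : Module.finrank F K / (minpoly F x).natDegree = Module.finrank L K := by
    rw [← IntermediateField.adjoin.finrank hx]
    refine Nat.div_eq_of_eq_mul_right Module.finrank_pos ?_
    exact (Module.finrank_mul_finrank F L K).symm
  rw [hfin, hxy, ← Algebra.norm_norm (S := L), Algebra.norm_algebraMap, map_pow]
  congr 1
  set E := AlgebraicClosure F
  apply (algebraMap F E).injective
  let pb := IntermediateField.adjoin.powerBasis hx
  have hmin : minpoly F pb.gen = minpoly F x := IntermediateField.minpoly_gen F x
  rw [Algebra.norm_eq_prod_embeddings F E, algebraMap_resultant_of_monic (minpoly.monic hx), ← hmin,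
    Fintype.prod_equiv pb.liftEquiv' (fun σ : L →ₐ[F] E => σ (aeval y f))
      (fun β => aeval (β : E) f)]
  · rw [Finset.prod_mem_multiset _ _ (fun β => aeval β f) fun _ => rfl,
      Finset.prod_eq_multiset_prod, Multiset.toFinset_val, Multiset.dedup_eq_self.mpr]
    rw [hmin]
    exact nodup_roots (Separable.map (Algebra.IsSeparable.isSeparable F x))
  · intro σ
    rw [PowerBasis.liftEquiv'_apply_coe, aeval_algHom_apply]
    rfl

theorem sum_mulChar_norm_aeval_eq_primePowerSum {F K : Type*} [Field F] [Fintype F] [Field K]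
    [Fintype K] [Algebra F K] (χ : MulChar F ℂ) (f : F[X]) :
    ∑ x : K, χ (Algebra.norm F (aeval x f)) =
      primePowerSum (resultantWeight χ f) (Module.finrank F K) := by
  classical
  have : FiniteDimensional F K := Module.Finite.of_finite
  have hj : Module.finrank F K ≠ 0 := Module.finrank_pos.ne'
  have hint : ∀ x : K, IsIntegral F x := fun x => Algebra.IsIntegral.isIntegral x
  rw [primePowerSum, Finset.sum_sigma',
    ← Finset.sum_fiberwise_of_maps_to (s := Finset.univ)
      (t := (Module.finrank F K).divisorsAntidiagonal.sigma fun x =>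
        monicIrreducibleOfDegree F x.1)
      (g := fun x : K => (⟨((minpoly F x).natDegree,
        Module.finrank F K / (minpoly F x).natDegree), minpoly F x⟩ : (_ : ℕ × ℕ) × F[X]))]
  swap
  · intro x _
    rw [Finset.mem_sigma, Nat.mem_divisorsAntidiagonal]
    dsimp only
    rw [mem_monicIrreducibleOfDegree]
    exact ⟨⟨Nat.mul_div_cancel' (minpoly.degree_dvd (hint x)), hj⟩, minpoly.monic (hint x), rfl,
      minpoly.irreducible (hint x)⟩
  refine Finset.sum_congr rfl ?_
  rintro ⟨⟨d, i⟩, P⟩ hP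
  rw [Finset.mem_sigma, Nat.mem_divisorsAntidiagonal, mem_monicIrreducibleOfDegree] at hP
  obtain ⟨⟨hdi, -⟩, hmon, hdeg, hirr⟩ := hP
  dsimp only at hdi hmon hdeg hirr ⊢
  have hd : 0 < d := hdeg ▸ hirr.natDegree_pos
  have hset : (Finset.univ.filter fun x : K => (⟨((minpoly F x).natDegree,
        Module.finrank F K / (minpoly F x).natDegree), minpoly F x⟩ : (_ : ℕ × ℕ) × F[X]) =
        ⟨(d, i), P⟩) = (P.rootSet K).toFinset := by
    ext x
    rw [Finset.mem_filter, Set.mem_toFinset, mem_rootSet]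
    constructor
    · rintro ⟨-, h⟩
      have : minpoly F x = P := by
        rw [Sigma.mk.injEq] at h
        exact eq_of_heq h.2
      exact ⟨hmon.ne_zero, this ▸ minpoly.aeval F x⟩
    · rintro ⟨-, h⟩
      have : minpoly F x = P := (minpoly.eq_of_irreducible_of_monic hirr h hmon).symm
      refine ⟨Finset.mem_univ _, ?_⟩
      rw [this, hdeg, ← hdi, Nat.mul_div_cancel_left _ hd]
  have hcard : (P.rootSet K).toFinset.card = d := by
    rw [Set.toFinset_card, ← hdeg]
    refine card_rootSet_eq_natDegree (PerfectField.separable_of_irreducible hirr) ?_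
    have : Fact (Irreducible P) := ⟨hirr⟩
    obtain ⟨φ⟩ := FiniteField.nonempty_algHom_of_finrank_dvd (F := F) (K := AdjoinRoot P) (L := K)
      (by
        rw [(AdjoinRoot.powerBasis hmon.ne_zero).finrank, AdjoinRoot.powerBasis_dim, hdeg, ← hdi]
        exact dvd_mul_right _ _)
    have hroot : aeval (φ (AdjoinRoot.root P)) P = 0 := by
      rw [aeval_algHom_apply, AdjoinRoot.aeval_eq, AdjoinRoot.mk_self, map_zero]
    have hm := minpoly.eq_of_irreducible_of_monic hirr hroot hmon
    rw [hm]
    exact Normal.splits inferInstance _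
  rw [hset, Finset.sum_congr rfl (g := fun _ => resultantWeight χ f P ^ i), Finset.sum_const,
    hcard, nsmul_eq_mul]
  intro x hx
  rw [Set.mem_toFinset, mem_rootSet] at hx
  have : minpoly F x = P := (minpoly.eq_of_irreducible_of_monic hirr hx.2 hmon).symm
  rw [norm_aeval_eq_resultant_minpoly_pow, this, hdeg, ← hdi, Nat.mul_div_cancel_left _ hd, map_pow,
    resultantWeight, hdeg]

/-- Unit complex numbers are simultaneously recurrent under taking powers. -/
theorem frequently_forall_half_le_re_pow {ι : Type*} (u : ι → Circle) [Finite ι] :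
    ∃ᶠ r in Filter.atTop, ∀ i, (1 / 2 : ℝ) ≤ ((u i : ℂ) ^ (r : ℕ)).re := by
  have h := (mapClusterPt_one_atTop_pow u).frequently
    (p := fun v => ∀ i, 1 / 2 ≤ (v i : ℂ).re) <| by
    rw [Filter.eventually_all]
    intro i
    have hcont : Continuous fun v : ι → Circle => (v i : ℂ).re := by fun_prop
    have hlt : (1 / 2 : ℝ) < ((1 : ι → Circle) i : ℂ).re := by norm_num
    filter_upwards [hcont.continuousAt.eventually (lt_mem_nhds hlt)] with v hv using hv.le
  simpa using h

/-- A bound on all power sums of finitely many complex numbers bounds each of them. -/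
theorem norm_le_of_norm_sum_pow_le {ι : Type*} [Fintype ι] (z : ι → ℂ) {B C : ℝ} (hB : 0 < B)
    (h : ∀ r : ℕ, r ≠ 0 → ‖∑ i, z i ^ r‖ ≤ C * B ^ r) (i : ι) : ‖z i‖ ≤ B := by
  by_contra! hi
  let u : ι → Circle := fun i => Circle.exp (z i).arg
  have hu : ∀ i, z i = ‖z i‖ * u i := fun i => by
    rw [Circle.coe_exp, Complex.norm_mul_exp_arg_mul_I]
  have htend := tendsto_pow_atTop_atTop_of_one_lt ((one_lt_div hB).mpr hi)
  obtain ⟨r, hr, hbig, hr0⟩ := ((frequently_forall_half_le_re_pow u).and_eventually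
    ((htend.eventually_gt_atTop (2 * C)).and (Filter.eventually_ne_atTop 0))).exists
  have hre : ∀ j, ‖z j‖ ^ r / 2 ≤ (z j ^ r).re := by
    intro j
    rw [hu j, mul_pow, ← Complex.ofReal_pow, Complex.re_ofReal_mul, ← hu j]
    have := mul_le_mul_of_nonneg_left (hr j) (pow_nonneg (norm_nonneg (z j)) r)
    linarith
  have h1 : ‖z i‖ ^ r / 2 ≤ (∑ j, z j ^ r).re := by
    rw [Complex.re_sum]
    refine (hre i).trans (Finset.single_le_sum (f := fun j => (z j ^ r).re) (fun j _ => ?_)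
      (Finset.mem_univ i))
    exact le_trans (by positivity) (hre j)
  have h2 := (h1.trans (Complex.re_le_norm _)).trans (h r hr0)
  rw [div_pow, lt_div_iff₀ (pow_pos hB r)] at hbig
  linarith

/-- The generating series of the power sums of a multiset of complex numbers. -/
noncomputable def powerSumSeries (ω : Multiset ℂ) : PowerSeries ℂ :=
  PowerSeries.mk fun j => if j = 0 then 0 else (ω.map (· ^ j)).sum

/-- Newton's identities as a statement about the logarithmic derivative of `∏ (1 - a X)`. -/
theorem X_mul_derivative_prod_one_sub (ω : Multiset ℂ) :
    PowerSeries.X * PowerSeries.derivative ℂ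
      (((ω.map fun a => (1 - C a * X : ℂ[X])).prod : ℂ[X]) : PowerSeries ℂ) =
    -((((ω.map fun a => (1 - C a * X : ℂ[X])).prod : ℂ[X]) : PowerSeries ℂ) *
      powerSumSeries ω) := by
  induction ω using Multiset.induction_on with
  | empty =>
    have : powerSumSeries 0 = 0 := by ext; simp [powerSumSeries]
    simp [this]
  | cons a ω ih =>
    have hadd : powerSumSeries (a ::ₘ ω) = powerSumSeries {a} + powerSumSeries ω := by
      ext j
      by_cases hj : j = 0 <;> simp [powerSumSeries, hj]
    have hsing : PowerSeries.C a * PowerSeries.X =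
        (1 - PowerSeries.C a * PowerSeries.X) * powerSumSeries {a} := by
      ext j
      rw [sub_mul, one_mul, mul_assoc, map_sub, PowerSeries.coeff_C_mul, PowerSeries.coeff_C_mul]
      rcases j with _ | _ | j
      · simp [powerSumSeries]
      · simp [powerSumSeries, PowerSeries.coeff_succ_X_mul]
      · simp [powerSumSeries, PowerSeries.coeff_succ_X_mul, PowerSeries.coeff_X, pow_succ]
        ring
    rw [Multiset.map_cons, Multiset.prod_cons, Polynomial.coe_mul, Derivation.leibniz, hadd]
    simp only [smul_eq_mul, mul_add]
    have hcoe : ((1 - C a * X : ℂ[X]) : PowerSeries ℂ) = 1 - PowerSeries.C a * PowerSeries.X := by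
      simp
    have hder : PowerSeries.derivative ℂ ((1 - C a * X : ℂ[X]) : PowerSeries ℂ) =
        -PowerSeries.C a := by
      rw [PowerSeries.derivative_coe]; simp
    rw [hder, hcoe]
    rw [mul_left_comm, ih]
    linear_combination -(((ω.map fun a => (1 - C a * X : ℂ[X])).prod : ℂ[X]) : PowerSeries ℂ) *
      hsing

theorem exists_eq_prod_one_sub (L : ℂ[X]) (hL : L.coeff 0 = 1) :
    ∃ ω : Multiset ℂ, Multiset.card ω = L.natDegree ∧
      L = (ω.map fun a => (1 - C a * X : ℂ[X])).prod := by
  have hs := IsAlgClosed.splits L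
  have hL0 : L ≠ 0 := fun h => by simp [h] at hL
  have hr : ∀ a ∈ L.roots, a ≠ 0 := by
    rintro a ha rfl
    rw [mem_roots hL0, IsRoot, ← coeff_zero_eq_eval_zero, hL] at ha
    exact one_ne_zero ha
  refine ⟨L.roots.map (·⁻¹), by simp [hs.natDegree_eq_card_roots], ?_⟩
  have h1 : (L.roots.map fun a => X - C a).prod =
      C (L.roots.map fun a => -a).prod * ((L.roots.map (·⁻¹)).map fun a => (1 - C a * X)).prod := by
    rw [map_multiset_prod, Multiset.map_map, Multiset.map_map, ← Multiset.prod_map_mul]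
    refine congrArg _ (Multiset.map_congr rfl fun a ha => ?_)
    have : C a * C a⁻¹ = 1 := by rw [← C_mul, mul_inv_cancel₀ (hr a ha), C_1]
    simp only [Function.comp_apply, C_neg]
    linear_combination (-X : ℂ[X]) * this
  have h2 : L = C (L.leadingCoeff * (L.roots.map fun a => -a).prod) *
      ((L.roots.map (·⁻¹)).map fun a => (1 - C a * X)).prod := by
    conv_lhs => rw [hs.eq_prod_roots, h1]
    rw [C_mul, mul_assoc]
  have h3 : L.leadingCoeff * (L.roots.map fun a => -a).prod = 1 := by
    have := congrArg (eval 0) h2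
    rw [← coeff_zero_eq_eval_zero, hL, eval_mul, eval_C, eval_multiset_prod,
      Multiset.map_map] at this
    simpa using this.symm
  rw [h3, C_1, one_mul] at h2
  exact h2

/-- If a sequence satisfies Newton's recursion for the coefficients of a polynomial with constant
term `1`, then it consists of negated power sums. -/
theorem exists_forall_eq_neg_sum_pow {c s : ℕ → ℂ} {k : ℕ} (hc0 : c 0 = 1)
    (hc : ∀ n, k + 1 ≤ n → c n = 0)
    (h : ∀ n : ℕ, (n : ℂ) * c n = ∑ j ∈ Finset.Icc 1 n, s j * c (n - j)) :
    ∃ ω : Multiset ℂ, Multiset.card ω ≤ k ∧ ∀ j, j ≠ 0 → s j = -(ω.map (· ^ j)).sum := by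
  set L : ℂ[X] := ∑ n ∈ Finset.range (k + 1), C (c n) * X ^ n with hLdef
  have hcoeff : ∀ n, L.coeff n = c n := by
    intro n
    simp only [hLdef, finsetSum_coeff, coeff_C_mul, coeff_X_pow, mul_ite, mul_one, mul_zero]
    rw [Finset.sum_ite_eq]
    split_ifs with hn
    · rfl
    · rw [Finset.mem_range] at hn
      exact (hc n (by omega)).symm
  obtain ⟨ω, hω, hL⟩ := exists_eq_prod_one_sub L (by rw [hcoeff, hc0])
  refine ⟨ω, ?_, ?_⟩
  · rw [hω]
    refine natDegree_le_iff_coeff_eq_zero.mpr fun n hn => ?_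
    rw [hcoeff, hc n hn]
  set S : PowerSeries ℂ := PowerSeries.mk fun j => if j = 0 then 0 else s j with hS
  have hL0 : (L : PowerSeries ℂ) ≠ 0 := by
    intro h0
    have := congrArg (PowerSeries.coeff 0) h0
    rw [Polynomial.coeff_coe, hcoeff, hc0] at this
    simp at this
  have hLS : PowerSeries.X * PowerSeries.derivative ℂ (L : PowerSeries ℂ) =
      (L : PowerSeries ℂ) * S := by
    ext n
    have e1 : PowerSeries.coeff n (PowerSeries.X * PowerSeries.derivative ℂ (L : PowerSeries ℂ)) =
        (n : ℂ) * c n := by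
      rcases n with _ | n
      · simp
      · rw [PowerSeries.coeff_succ_X_mul, PowerSeries.coeff_derivative, Polynomial.coeff_coe,
          hcoeff]
        push_cast
        ring
    rw [e1, h, mul_comm, PowerSeries.coeff_mul, Finset.Nat.sum_antidiagonal_eq_sum_range_succ_mk]
    simp only [hS, PowerSeries.coeff_mk, Polynomial.coeff_coe, hcoeff]
    symm
    refine Finset.sum_subset_zero_on_sdiff ?_ ?_ ?_ |>.symm
    · intro j hj
      simp only [Finset.mem_Icc, Finset.mem_range] at *
      omega
    · intro j hj
      have : j = 0 := by
        simp only [Finset.mem_sdiff, Finset.mem_Icc, Finset.mem_range] at hj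
        omega
      simp [this]
    · intro j hj
      rw [Finset.mem_Icc] at hj
      rw [if_neg (by omega)]
  have hST : S = -powerSumSeries ω := by
    apply mul_left_cancel₀ hL0
    rw [← hLS, hL, X_mul_derivative_prod_one_sub, mul_neg]
  intro j hj
  have := congrArg (PowerSeries.coeff j) hST
  simpa [hS, powerSumSeries, hj] using this

/-- The Weil bound for multiplicative character sums over polynomials with a simple root at `0`. -/
theorem norm_sum_mulChar_eval_le {F : Type*} [Field F] [Fintype F] {χ : MulChar F ℂ}
    (hχ : χ ≠ 1) {f : F[X]} (hf : f.Monic) (hf0 : f.coeff 0 = 0) (hf1 : f.coeff 1 ≠ 0) :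
    ‖∑ t : F, χ (f.eval t)‖ ≤ ((f.natDegree : ℝ) - 1) * Real.sqrt (Fintype.card F) := by
  classical
  have hdeg : 1 ≤ f.natDegree := le_natDegree_of_ne_zero hf1
  have hq : 3 ≤ Fintype.card F := by
    by_contra! hlt
    obtain ⟨v, hv⟩ := MulChar.ne_one_iff.mp hχ
    have : Fintype.card Fˣ = 1 := by
      have := Fintype.one_lt_card (α := F)
      rw [Fintype.card_units]
      omega
    have := Fintype.card_le_one_iff_subsingleton.mp this.le
    rw [Subsingleton.elim v 1] at hv
    simp at hv
  obtain ⟨ω, hcard, hω⟩ := exists_forall_eq_neg_sum_pow (k := f.natDegree - 1)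
    (lCoeff_zero (isMonicMultiplicative_resultantWeight χ f))
    (fun n hn => lCoeff_resultantWeight_eq_zero hχ hf hf0 hf1 (by omega))
    (isMonicMultiplicative_resultantWeight χ f).natCast_mul_lCoeff
  have hq0 : (0 : ℝ) < Fintype.card F := by positivity
  have hbound : ∀ z ∈ ω, ‖z‖ ≤ Real.sqrt (Fintype.card F) := by
    have key := norm_le_of_norm_sum_pow_le (fun x : ω => (x.1 : ℂ) ^ 2)
      (C := ((Fintype.card F * (3 * f.natDegree + 3) + f.natDegree : ℕ) : ℝ)) hq0 fun r hr => by
        obtain ⟨p, hp⟩ := CharP.exists F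
        have : Fact p.Prime := ⟨CharP.char_is_prime F p⟩
        have : NeZero (2 * r) := ⟨by omega⟩
        let K := FiniteField.Extension F p (2 * r)
        have : Fintype K := Fintype.ofFinite K
        have hfin : Module.finrank F K = 2 * r := FiniteField.finrank_extension F p (2 * r)
        have h := norm_sum_mulChar_norm_aeval_le (K := K) hr hfin hq hχ f le_rfl hf0 hf1
        rw [sum_mulChar_norm_aeval_eq_primePowerSum, hfin, hω _ (by omega), norm_neg,
          ← Multiset.map_univ] at h
        simp only [← pow_mul]
        exact h
    intro z hz
    have := key ⟨z, ⟨0, Multiset.count_pos.mpr hz⟩⟩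
    rw [norm_pow] at this
    exact Real.le_sqrt_of_sq_le this
  have h1 := sum_mulChar_norm_aeval_eq_primePowerSum (K := F) χ f
  simp only [Algebra.norm_self, MonoidHom.id_apply, coe_aeval_eq_eval, Module.finrank_self,
    hω 1 one_ne_zero, pow_one, Multiset.map_id'] at h1
  rw [h1, norm_neg]
  calc ‖ω.sum‖ ≤ (ω.map fun z => ‖z‖).sum := norm_multiset_sum_le ω
    _ ≤ (ω.map fun z => ‖z‖).card • Real.sqrt (Fintype.card F) := by
        refine Multiset.sum_le_card_nsmul _ _ fun x hx => ?_
        obtain ⟨z, hz, rfl⟩ := Multiset.mem_map.mp hx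
        exact hbound z hz
    _ ≤ ((f.natDegree : ℝ) - 1) * Real.sqrt (Fintype.card F) := by
        rw [Multiset.card_map, nsmul_eq_mul]
        gcongr
        rw [le_sub_iff_add_le]
        exact_mod_cast (by omega : ω.card + 1 ≤ f.natDegree)

theorem MulChar.exists_orderOf_eq_gcd_sum_pow_re_le {F : Type*} [Field F] [Fintype F]
    [DecidableEq F] (n : ℕ) :
    ∃ χ : MulChar F ℂ, orderOf χ = Nat.gcd n (Fintype.card F - 1) ∧
      ∀ u ≠ 0, (∑ i ∈ Finset.range (orderOf χ), χ u ^ i).re ≤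
        (Finset.univ.filter fun x : F => x ≠ 0 ∧ x ^ n = u).card := by
  have hq : Fintype.card F - 1 ≠ 0 := by
    have := Fintype.one_lt_card (α := F)
    omega
  have hm0 : Nat.gcd n (Fintype.card F - 1) ≠ 0 := Nat.gcd_ne_zero_right hq
  obtain ⟨χ, hχ⟩ := MulChar.exists_mulChar_orderOf F (Nat.gcd_dvd_right n (Fintype.card F - 1))
    (Complex.isPrimitiveRoot_exp _ hm0)
  refine ⟨χ, hχ, fun u hu => ?_⟩
  have hcardU : Nat.card Fˣ = Fintype.card F - 1 := by
    rw [Nat.card_eq_fintype_card, Fintype.card_units]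
  have hroot : χ u ^ orderOf χ = 1 := by
    rw [← MulChar.pow_apply' _ (hχ ▸ hm0), pow_orderOf_eq_one, MulChar.one_apply hu.isUnit]
  by_cases h1 : χ u = 1
  · obtain ⟨g, hg⟩ := IsCyclic.exists_generator (α := Fˣ)
    obtain ⟨a, ha⟩ := (mem_powers_iff_mem_zpowers.mpr (hg (Units.mk0 u hu)))
    have hdvd : orderOf χ ∣ a := by
      rw [orderOf_dvd_iff_pow_eq_one, MulChar.eq_iff hg, MulChar.one_apply_coe,
        MulChar.pow_apply_coe, ← _root_.map_pow, ← h1]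
      congr 1
      simpa using congrArg Units.val ha
    obtain ⟨s, rfl⟩ := hdvd
    have hgm : ∃ x : Fˣ, x ^ n = Units.mk0 u hu := by
      refine ⟨(g ^ Nat.gcdA n (Fintype.card F - 1)) ^ s, ?_⟩
      have hg1 : g ^ (((Fintype.card F - 1 : ℕ) : ℤ) * Nat.gcdB n (Fintype.card F - 1)) = 1 := by
        rw [zpow_mul, zpow_natCast, ← hcardU, pow_card_eq_one', one_zpow]
      have : g ^ (orderOf χ) = (g ^ Nat.gcdA n (Fintype.card F - 1)) ^ n := by
        rw [hχ, ← zpow_natCast g, Nat.gcd_eq_gcd_ab, zpow_add, hg1, mul_one, mul_comm, zpow_mul,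
          zpow_natCast]
      dsimp only at ha
      rw [← ha, pow_mul, this, ← pow_mul, ← pow_mul, mul_comm]
    obtain ⟨x₀, hx₀⟩ := hgm
    have hker : Nat.card (powMonoidHom n : Fˣ →* Fˣ).ker = orderOf χ := by
      rw [IsCyclic.card_powMonoidHom_ker, hcardU, hχ, Nat.gcd_comm]
    have hle : orderOf χ ≤ (Finset.univ.filter fun x : F => x ≠ 0 ∧ x ^ n = u).card := by
      rw [← hker, Nat.card_eq_fintype_card, ← Finset.card_univ]
      refine Finset.card_le_card_of_injOn (fun z => ((z : Fˣ) * x₀ : Fˣ)) ?_ ?_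
      · intro z _
        have hz : (z : Fˣ) ^ n = 1 := z.2
        simp only [Finset.coe_filter, Finset.mem_univ, true_and, Set.mem_ofPred_eq]
        refine ⟨Units.ne_zero _, ?_⟩
        rw [← Units.val_pow_eq_pow_val, mul_pow, hz, hx₀, one_mul, Units.val_mk0]
      · intro z _ z' _ h
        exact Subtype.ext (mul_right_cancel (Units.ext h))
    simpa [h1] using hle
  · rw [geom_sum_eq h1, hroot, sub_self, zero_div, Complex.zero_re]
    positivity

theorem exists_polynomial_mul_X_sub_one {F : Type*} [Field F] {k : ℕ} (hk : k ≠ 0) :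
    ∃ f : F[X], f.Monic ∧ f.natDegree = k ∧ f.coeff 0 = 0 ∧ f.coeff 1 ≠ 0 ∧
      f * (X - 1) = X * (X ^ k - 1) := by
  have hmon : (∑ i ∈ Finset.range k, (X : F[X]) ^ i).Monic := monic_geom_sum_X hk
  have hmul : (X * ∑ i ∈ Finset.range k, (X : F[X]) ^ i) * (X - 1) = X * (X ^ k - 1) := by
    rw [mul_assoc, geom_sum_mul]
  refine ⟨X * ∑ i ∈ Finset.range k, X ^ i, monic_X.mul hmon, ?_, by simp, ?_, hmul⟩
  · have h := congrArg natDegree hmul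
    rw [← C_1, (monic_X.mul hmon).natDegree_mul (monic_X_sub_C 1), natDegree_X_sub_C,
      monic_X.natDegree_mul (monic_X_pow_sub_C 1 hk), natDegree_X, natDegree_X_pow_sub_C] at h
    omega
  · rw [coeff_X_mul, coeff_zero_eq_eval_zero, eval_geom_sum]
    obtain ⟨k, rfl⟩ := Nat.exists_eq_succ_of_ne_zero hk
    simp [Finset.sum_range_succ']

theorem sum_re_sum_pow_mulChar_ge {F : Type*} [Field F] [Fintype F] [DecidableEq F]
    (χ : MulChar F ℂ) {f : F[X]} (hf : f.Monic) (hf0 : f.coeff 0 = 0) (hf1 : f.coeff 1 ≠ 0)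
    (a w : F) (hχ : orderOf χ ≠ 0) :
    (Fintype.card F : ℝ) - 1 - f.natDegree - ((orderOf χ : ℝ) - 1) *
        (((f.natDegree : ℝ) - 1) * Real.sqrt (Fintype.card F) + 1) ≤
      ∑ t ∈ Finset.univ.filter (fun t : F => t ≠ w ∧ f.eval t ≠ 0),
        (∑ i ∈ Finset.range (orderOf χ), χ (a / f.eval t) ^ i).re := by
  set T := Finset.univ.filter (fun t : F => t ≠ w ∧ f.eval t ≠ 0) with hT
  obtain ⟨m, hm⟩ := Nat.exists_eq_succ_of_ne_zero hχ
  have hTcard : (Fintype.card F : ℝ) - 1 - f.natDegree ≤ T.card := by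
    have hsub : Finset.univ ⊆ T ∪ ({w} ∪ f.roots.toFinset) := by
      intro t _
      simp only [hT, Finset.mem_union, Finset.mem_filter, Finset.mem_univ, true_and,
        Finset.mem_singleton, Multiset.mem_toFinset, mem_roots hf.ne_zero, IsRoot.def]
      tauto
    have h1 := Finset.card_le_card hsub
    have h2 := Finset.card_union_le T ({w} ∪ f.roots.toFinset)
    have h3 := Finset.card_union_le {w} f.roots.toFinset
    have h4 := (Multiset.toFinset_card_le f.roots).trans (card_roots' f)
    rw [Finset.card_univ] at h1
    rw [Finset.card_singleton] at h3
    have : Fintype.card F ≤ T.card + 1 + f.natDegree := by omega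
    have : (Fintype.card F : ℝ) ≤ T.card + 1 + f.natDegree := by exact_mod_cast this
    linarith
  have hterm : ∀ i ∈ Finset.range m, -(((f.natDegree : ℝ) - 1) * Real.sqrt (Fintype.card F) + 1) ≤
      (∑ t ∈ T, χ (a / f.eval t) ^ (i + 1)).re := by
    intro i hi
    set ψ : MulChar F ℂ := (χ ^ (i + 1))⁻¹ with hψ
    have hψ1 : ψ ≠ 1 := by
      rw [hψ, Ne, inv_eq_one]
      exact pow_ne_one_of_lt_orderOf i.succ_ne_zero (by rw [hm]; simpa using hi)
    have hval : ∀ t, χ (a / f.eval t) ^ (i + 1) = (χ ^ (i + 1)) a * ψ (f.eval t) := by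
      intro t
      rw [hψ, MulChar.inv_apply', ← _root_.map_mul, ← div_eq_mul_inv,
        MulChar.pow_apply' _ i.succ_ne_zero]
    have hsum : ∑ t ∈ T, ψ (f.eval t) = ∑ t, ψ (f.eval t) - ψ (f.eval w) := by
      rw [← Finset.sum_erase_eq_sub (Finset.mem_univ w)]
      refine Finset.sum_subset ?_ ?_
      · intro t ht
        exact Finset.mem_erase.mpr ⟨(Finset.mem_filter.mp ht).2.1, Finset.mem_univ _⟩
      · intro t ht ht'
        have : f.eval t = 0 := by
          by_contra h
          exact ht' (Finset.mem_filter.mpr ⟨Finset.mem_univ _, (Finset.mem_erase.mp ht).1, h⟩)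
        rw [this, MulChar.map_zero]
    have hnorm : ‖∑ t ∈ T, χ (a / f.eval t) ^ (i + 1)‖ ≤
        ((f.natDegree : ℝ) - 1) * Real.sqrt (Fintype.card F) + 1 := by
      rw [Finset.sum_congr rfl fun t _ => hval t, ← Finset.mul_sum, norm_mul, hsum]
      calc _ ≤ 1 * ‖∑ t, ψ (f.eval t) - ψ (f.eval w)‖ := by
            gcongr
            exact MulChar.norm_apply_le_one _ _
        _ ≤ ‖∑ t, ψ (f.eval t)‖ + ‖ψ (f.eval w)‖ := by
            rw [one_mul]
            exact norm_sub_le _ _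
        _ ≤ _ := add_le_add (norm_sum_mulChar_eval_le hψ1 hf hf0 hf1)
            (MulChar.norm_apply_le_one _ _)
    exact (neg_le_neg hnorm).trans (abs_le.mp (Complex.abs_re_le_norm _)).1
  have hsplit : ∑ t ∈ T, (∑ i ∈ Finset.range (orderOf χ), χ (a / f.eval t) ^ i).re =
      T.card + ∑ i ∈ Finset.range m, (∑ t ∈ T, χ (a / f.eval t) ^ (i + 1)).re := by
    rw [← Complex.re_sum, Finset.sum_comm, hm, Finset.sum_range_succ', Complex.add_re,
      Complex.re_sum, add_comm]
    simp
  have hsum := Finset.card_nsmul_le_sum _ _ _ hterm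
  rw [Finset.card_range, nsmul_eq_mul] at hsum
  rw [hsplit, hm]
  push_cast
  linarith

theorem card_sigma_le_ncard_collisions {F : Type*} [Field F] [Fintype F] [DecidableEq F] {k : ℕ}
    {b c : F} (hc : c ≠ 0) {f : F[X]} (hf0 : f.coeff 0 = 0)
    (hf : f * (X - 1) = X * (X ^ k - 1)) :
    ∑ t ∈ Finset.univ.filter (fun t : F => t ≠ 1 ∧ f.eval t ≠ 0),
        (Finset.univ.filter fun x : F => x ≠ 0 ∧ x ^ (k + 1) = b / c / f.eval t).card ≤
      {p : F × F | p.1 ≠ 0 ∧ p.2 ≠ 0 ∧ p.1 ≠ p.2 ∧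
        c * p.1 ^ k + b / p.1 = c * p.2 ^ k + b / p.2}.ncard := by
  rw [← Finset.card_sigma, ← Set.ncard_coe_finset]
  refine Set.ncard_le_ncard_of_injOn (fun z : (_ : F) × F => (z.2, z.1 * z.2)) ?_ ?_
    (Set.toFinite _)
  · rintro ⟨t, x⟩ h
    simp only [Finset.mem_coe, Finset.mem_sigma, Finset.mem_filter, Finset.mem_univ,
      true_and] at h
    obtain ⟨⟨ht1, hft⟩, hx, hxk⟩ := h
    have ht0 : t ≠ 0 := by
      rintro rfl
      exact hft (by rw [← coeff_zero_eq_eval_zero, hf0])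
    refine ⟨hx, mul_ne_zero ht0 hx, fun h => ht1 ?_, ?_⟩
    · exact mul_right_cancel₀ hx (by simpa using h.symm)
    · have he := congrArg (eval t) hf
      simp only [eval_mul, eval_sub, eval_X, eval_one, eval_pow] at he
      have hxk' : c * x ^ (k + 1) * f.eval t = b := by
        rw [hxk]
        field_simp
      rw [← hxk']
      dsimp only
      field_simp
      rw [mul_pow]
      linear_combination x ^ (k + 1) * he
  · rintro ⟨t, x⟩ h ⟨t', x'⟩ _ he
    simp only [Finset.mem_coe, Finset.mem_sigma, Finset.mem_filter, Finset.mem_univ,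
      true_and] at h
    obtain ⟨rfl, h2⟩ := Prod.mk.inj he
    exact congrArg (fun s => (⟨s, x⟩ : (_ : F) × F)) (mul_right_cancel₀ h.2.1 h2)

end

theorem monomial_collision_count_lower_bound
    {F : Type*} [Field F] [Fintype F] (q k : ℕ)
    (hq : Fintype.card F = q)
    (b c : F) (hb : b ≠ 0) (hc : c ≠ 0)
    (hk1 : 1 ≤ k) (hk2 : k < q - 1) :
    (({p : F × F | p.1 ≠ 0 ∧ p.2 ≠ 0 ∧ p.1 ≠ p.2 ∧
        c * p.1 ^ k + b / p.1 = c * p.2 ^ k + b / p.2}.ncard : ℝ)) ≥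
      (q : ℝ) - ((k : ℝ) - 1) * ((Nat.gcd (k + 1) (q - 1) : ℝ) - 1) * Real.sqrt q
        - (4 * (k : ℝ) + 1) := by
  classical
  subst hq
  obtain ⟨χ, hχ, hsol⟩ := MulChar.exists_orderOf_eq_gcd_sum_pow_re_le (F := F) (k + 1)
  obtain ⟨f, hf, hdeg, hf0, hf1, hmul⟩ :=
    exists_polynomial_mul_X_sub_one (F := F) (Nat.one_le_iff_ne_zero.mp hk1)
  have hbc : b / c ≠ 0 := div_ne_zero hb hc
  have hchar := sum_re_sum_pow_mulChar_ge χ hf hf0 hf1 (b / c) 1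
    (hχ ▸ Nat.gcd_ne_zero_left k.succ_ne_zero)
  have hcount : ((∑ t ∈ Finset.univ.filter (fun t : F => t ≠ 1 ∧ f.eval t ≠ 0),
      (Finset.univ.filter fun x : F => x ≠ 0 ∧ x ^ (k + 1) = b / c / f.eval t).card : ℕ) : ℝ) ≤ _ :=
    Nat.cast_le.mpr (card_sigma_le_ncard_collisions (b := b) hc hf0 hmul)
  have hle := Finset.sum_le_sum fun t (ht : t ∈ Finset.univ.filter
    (fun t : F => t ≠ 1 ∧ f.eval t ≠ 0)) =>
      hsol _ (div_ne_zero hbc (Finset.mem_filter.mp ht).2.2)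
  rw [Nat.cast_sum] at hcount
  have hm : (Nat.gcd (k + 1) (Fintype.card F - 1) : ℝ) ≤ k + 1 := by
    exact_mod_cast Nat.gcd_le_left _ k.succ_pos
  rw [hdeg, hχ] at hchar
  rw [hχ] at hle
  refine ge_iff_le.mpr (le_trans ?_ ((hchar.trans hle).trans hcount))
  have : (0 : ℝ) ≤ k := k.cast_nonneg
  linarith
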